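/- There is no 'bad configuration' with 6 points for the convex 5-gon game: for every set P of 6 points in general position containing no 5 points in convex position, there exists a point x such that P ∪ {x} is in general position and still contains no 5 points in convex position. -/

import Mathlib

open scoped Classical
noncomputable section

/-- Points in the plane. -/
abbrev Pt := ℝ × ℝ

/-- Signed area determinant of the triple (p, q, r). -/
def det (p q r : Pt) : ℝ := (q.1 - p.1) * (r.2 - p.2) - (q.2 - p.2) * (r.1 - p.1)

/-- A finite point set is in general position if no three distinct points are collinear. -/
def GenPos (S : Finset Pt) : Prop :=
  ∀ p ∈ S, ∀ q ∈ S, ∀ r ∈ S, p ≠ q → p ≠ r → q ≠ r → ¬ Collinear ℝ ({p, q, r} : Set Pt)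

/-- A finite point set is in convex position if no point lies in the
convex hull of the others. -/
def ConvexPos (S : Finset Pt) : Prop :=
  ∀ p ∈ S, p ∉ convexHull ℝ ((S.erase p : Finset Pt) : Set Pt)

/-- The vertices of the convex hull of a finite point set. -/
def hullVerts (S : Finset Pt) : Finset Pt :=
  S.filter (fun p => p ∉ convexHull ℝ ((S.erase p : Finset Pt) : Set Pt))

/-- `S` is an empty convex pentagon of the point set `P`. -/
def EmptyConvexPentagon (P S : Finset Pt) : Prop :=
  S ⊆ P ∧ S.card = 5 ∧ ConvexPos S ∧
    ∀ p ∈ P, p ∉ S → p ∉ interior (convexHull ℝ (S : Set Pt))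

/-- Type-1 beam `a : bc`: the convex cone with apex `a` spanned by the rays from `a`
through `b` and through `c`, minus the triangle `abc`. -/
def beam1 (a b c : Pt) : Set Pt :=
  {x | (∃ s t : ℝ, 0 ≤ s ∧ 0 ≤ t ∧ x = a + s • (b - a) + t • (c - a)) ∧
       x ∉ convexHull ℝ ({a, b, c} : Set Pt)}

/-- Type-2 beam `pq : rs`: the convex region bounded by the segment `pq`, the ray
from `p` through `s` and the ray from `q` through `r`, minus the quadrilateral `pqrs`. -/
def beam2 (p q r s : Pt) : Set Pt :=
  {x | (∃ y ∈ segment ℝ p q, ∃ u v : ℝ, 0 ≤ u ∧ 0 ≤ v ∧ x = y + u • (s - p) + v • (r - q)) ∧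
       x ∉ convexHull ℝ ({p, q, r, s} : Set Pt)}

/-- The O-region of triangle `abc` opposite the vertex `a`: points separated from `a`
by line `bc`, on the same side of line `ac` as `b`, and on the same side of line `ab` as `c`. -/
def ORegionOpp (a b c : Pt) : Set Pt :=
  {x | det b c x * det b c a < 0 ∧ det a c x * det a c b > 0 ∧ det a b x * det a b c > 0}

/-- The I-region of triangle (or quadrilateral) at vertex `a` relative to the remaining
vertex set `R`: points `x` such that `a` lies strictly inside the convex hull of `{x} ∪ R`. -/
def IRegion (a : Pt) (R : Set Pt) : Set Pt :=
  {x | a ∈ interior (convexHull ℝ (insert x R))}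

/-- A convex quadrilateral with vertices `a b c d` in this cyclic order. -/
def CyclicQuad (a b c d : Pt) : Prop :=
  ConvexPos ({a, b, c, d} : Finset Pt) ∧ ({a, b, c, d} : Finset Pt).card = 4 ∧
    det a c b * det a c d < 0 ∧ det b d a * det b d c < 0

open Filter Topology

theorem det_swap_right (p q r : Pt) : det p r q = -det p q r := by unfold det; ring

theorem det_rotate (p q r : Pt) : det q r p = det p q r := by unfold det; ring

@[simp] theorem det_self_left (p q : Pt) : det p p q = 0 := by unfold det; ring

@[simp] theorem det_self_right (p q : Pt) : det p q q = 0 := by unfold det; ring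

@[simp] theorem det_self_outer (p q : Pt) : det p q p = 0 := by unfold det; ring

theorem continuous_det {X : Type*} [TopologicalSpace X] {f g h : X → Pt}
    (hf : Continuous f) (hg : Continuous g) (hh : Continuous h) :
    Continuous fun x => det (f x) (g x) (h x) := by
  unfold det; fun_prop

/-- The cross product of two plane vectors. -/
def cross (v w : Pt) : ℝ := v.1 * w.2 - v.2 * w.1

theorem det_eq_cross (p q r : Pt) : det p q r = cross (q - p) (r - p) := rfl

theorem collinear_iff_det_eq_zero (p q r : Pt) :
    Collinear ℝ ({p, q, r} : Set Pt) ↔ det p q r = 0 := by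
  constructor
  · intro h
    obtain ⟨v, hv⟩ := (collinear_iff_of_mem (p₀ := p) (by simp)).1 h
    obtain ⟨a, rfl⟩ := hv q (by simp)
    obtain ⟨b, rfl⟩ := hv r (by simp)
    simp [det]
    ring
  · intro h
    rcases eq_or_ne q p with rfl | hqp
    · simpa using collinear_pair ℝ q r
    rw [collinear_iff_of_mem (p₀ := p) (by simp)]
    refine ⟨q - p, ?_⟩
    have hr : ∃ c : ℝ, r = c • (q - p) +ᵥ p := by
      by_cases h1 : q.1 = p.1
      · have h2 : q.2 - p.2 ≠ 0 := fun h2 => hqp (Prod.ext h1 (sub_eq_zero.1 h2))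
        have h3 : r.1 - p.1 = 0 := by
          simpa [det, h1, h2] using h
        refine ⟨(r.2 - p.2) / (q.2 - p.2), Prod.ext ?_ ?_⟩
        · simp [h1, sub_eq_zero.1 h3]
        · simp [div_mul_cancel₀ _ h2]
      · have h2 : q.1 - p.1 ≠ 0 := sub_ne_zero.2 h1
        refine ⟨(r.1 - p.1) / (q.1 - p.1), Prod.ext ?_ ?_⟩
        · simp [div_mul_cancel₀ _ h2]
        · unfold det at h
          simp only [vadd_eq_add, Prod.snd_add, Prod.smul_snd, Prod.snd_sub, smul_eq_mul]
          field_simp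
          linarith
    rintro y (rfl | rfl | rfl)
    · exact ⟨0, by simp⟩
    · exact ⟨1, by simp⟩
    · exact hr

theorem GenPos.det_ne_zero {P : Finset Pt} (h : GenPos P) {p q r : Pt} (hp : p ∈ P) (hq : q ∈ P)
    (hr : r ∈ P) (hpq : p ≠ q) (hpr : p ≠ r) (hqr : q ≠ r) : det p q r ≠ 0 :=
  fun h0 => h p hp q hq r hr hpq hpr hqr ((collinear_iff_det_eq_zero p q r).2 h0)

theorem GenPos.insert_of_det_ne_zero {P : Finset Pt} (h : GenPos P) {x : Pt}
    (hx : ∀ q ∈ P, ∀ r ∈ P, q ≠ r → det x q r ≠ 0) : GenPos (insert x P) := by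
  intro p hp q hq r hr hpq hpr hqr
  rw [collinear_iff_det_eq_zero]
  rw [Finset.mem_insert] at hp hq hr
  rcases hp with rfl | hp
  · exact hx q (hq.resolve_left hpq.symm) r (hr.resolve_left hpr.symm) hqr
  rcases hq with rfl | hq
  · rw [← det_rotate]
    exact hx r (hr.resolve_left hqr.symm) p hp hpr.symm
  rcases hr with rfl | hr
  · rw [← det_rotate, ← det_rotate]
    exact hx p hp q hq hpq
  · exact h.det_ne_zero hp hq hr hpq hpr hqr

theorem ConvexPos.mono {S T : Finset Pt} (hT : ConvexPos T) (h : S ⊆ T) : ConvexPos S :=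
  fun p hp hmem => hT p (h hp) <|
    convexHull_mono (by exact_mod_cast Finset.erase_subset_erase p h) hmem

/-- The point `t` is inside the counterclockwise triangle `abc`. -/
def Inside (a b c t : Pt) : Prop :=
  0 < det a b t ∧ 0 < det b c t ∧ 0 < det c a t

theorem Inside.mem_convexHull {a b c t : Pt} (h : Inside a b c t) :
    t ∈ convexHull ℝ ({a, b, c} : Set Pt) := by
  obtain ⟨h1, h2, h3⟩ := h
  have hsum : det b c t + det c a t + det a b t = det a b c := by unfold det; ring
  have hpos : 0 < det a b c := by linarith
  have ht : t = (det b c t / det a b c) • a + (det c a t / det a b c) • b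
      + (det a b t / det a b c) • c := by
    ext
    · simp only [Prod.fst_add, Prod.smul_fst, smul_eq_mul]
      field_simp
      unfold det; ring
    · simp only [Prod.snd_add, Prod.smul_snd, smul_eq_mul]
      field_simp
      unfold det; ring
  rw [ht]
  have hmem : ∀ y ∈ ({a, b, c} : Set Pt), y ∈ convexHull ℝ ({a, b, c} : Set Pt) :=
    fun y hy => subset_convexHull ℝ _ hy
  have := (convex_convexHull ℝ ({a, b, c} : Set Pt)).sum_mem (t := Finset.univ)
    (w := ![det b c t / det a b c, det c a t / det a b c, det a b t / det a b c])
    (z := ![a, b, c]) (by intro i _; fin_cases i <;> simp <;> positivity)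
    (by simp [Fin.sum_univ_three, ← add_div, hsum, hpos.ne'])
    (by intro i _; fin_cases i <;> exact hmem _ (by simp))
  simpa [Fin.sum_univ_three] using this

theorem Inside.not_convexPos {a b c t : Pt} (h : Inside a b c t) {S : Finset Pt}
    (ha : a ∈ S) (hb : b ∈ S) (hc : c ∈ S) (ht : t ∈ S) : ¬ ConvexPos S := by
  intro hS
  refine hS t ht (convexHull_mono ?_ h.mem_convexHull)
  obtain ⟨h1, h2, h3⟩ := h
  have hat : a ≠ t := by rintro rfl; simp at h1
  have hbt : b ≠ t := by rintro rfl; simp at h1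
  have hct : c ≠ t := by rintro rfl; simp at h2
  rintro y (rfl | rfl | rfl) <;> simp [*]

theorem GenPos.exists_inside {S : Finset Pt} (h : GenPos S) (hS : ¬ ConvexPos S) :
    ∃ a ∈ S, ∃ b ∈ S, ∃ c ∈ S, ∃ t ∈ S, Inside a b c t := by
  unfold ConvexPos at hS
  push Not at hS
  obtain ⟨t, htS, ht⟩ := hS
  obtain ⟨ι, _, z, w, hz, hind, hw, hsum, rfl⟩ := eq_pos_convex_span_of_mem_convexHull ht
  have hzmem : ∀ i, z i ∈ S ∧ z i ≠ ∑ i, w i • z i := fun i => by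
    have := hz ⟨i, rfl⟩
    simp only [Finset.coe_erase, Set.mem_sdiff, Finset.mem_coe, Set.mem_singleton_iff] at this
    exact this
  have hcard : Fintype.card ι ≤ 3 := by
    have h1 := hind.card_le_finrank_succ
    have h2 : Module.finrank ℝ (vectorSpan ℝ (Set.range z)) ≤ 2 := by
      simpa using Submodule.finrank_le (vectorSpan ℝ (Set.range z))
    exact h1.trans (Nat.succ_le_succ h2)
  have hinj := hind.injective
  generalize hn : Fintype.card ι = n at hcard
  let e := (Fintype.equivFinOfCardEq hn).symm
  have hsum' : ∑ i, w (e i) = 1 := by rw [← hsum]; exact e.sum_comp w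
  have ht' : ∑ i, w (e i) • z (e i) = ∑ i, w i • z i := e.sum_comp fun i => w i • z i
  have hz' := fun i => hzmem (e i)
  have hw' := fun i => hw (e i)
  have hinj' : Function.Injective fun i => z (e i) := hinj.comp e.injective
  clear_value e
  generalize ∑ i, w i • z i = t at *
  subst ht'
  interval_cases n
  · simp at hsum'
  · simp only [Fin.sum_univ_one] at *
    exact absurd (by rw [hsum', one_smul]) (hz' 0).2
  · have h01 : z (e 0) ≠ z (e 1) := fun h0 => by simpa using hinj' h0
    refine absurd ?_ (h.det_ne_zero (hz' 0).1 (hz' 1).1 htS h01 (hz' 0).2 (hz' 1).2)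
    simp only [Fin.sum_univ_two] at *
    rw [← eq_sub_iff_add_eq'] at hsum'
    rw [hsum']
    simp [det]
    ring
  · have h01 : z (e 0) ≠ z (e 1) := fun h0 => by simpa using hinj' h0
    have h02 : z (e 0) ≠ z (e 2) := fun h0 => by simpa using hinj' h0
    have h12 : z (e 1) ≠ z (e 2) := fun h0 => by simpa using hinj' h0
    have hdet := h.det_ne_zero (hz' 0).1 (hz' 1).1 (hz' 2).1 h01 h02 h12
    simp only [Fin.sum_univ_three] at *
    have hw0 := hw' 0
    have hw1 := hw' 1
    have hw2 := hw' 2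
    have key : ∀ a b c : Pt, ∀ u v r : ℝ, u + v + r = 1 →
        det a b (u • a + v • b + r • c) = r * det a b c := by
      intro a b c u v r huvr
      obtain rfl : u = 1 - v - r := by linarith
      simp [det]
      ring
    have key' : ∀ a b c : Pt, ∀ u v r : ℝ, 0 < u → 0 < v → 0 < r → u + v + r = 1 →
        0 < det a b c → Inside a b c (u • a + v • b + r • c) := by
      intro a b c u v r hu hv hr huvr habc
      refine ⟨?_, ?_, ?_⟩
      · rw [key a b c u v r huvr]; positivity
      · rw [show u • a + v • b + r • c = v • b + r • c + u • a by abel,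
          key b c a v r u (by linarith), det_rotate]; positivity
      · rw [show u • a + v • b + r • c = r • c + u • a + v • b by abel,
          key c a b r u v (by linarith), det_rotate, det_rotate]; positivity
    rcases hdet.lt_or_gt with hneg | hpos
    · refine ⟨_, (hz' 0).1, _, (hz' 2).1, _, (hz' 1).1, _, htS, ?_⟩
      rw [add_right_comm]
      exact key' _ _ _ _ _ _ hw0 hw2 hw1 (by linarith) (by rw [det_swap_right]; linarith)
    · exact ⟨_, (hz' 0).1, _, (hz' 1).1, _, (hz' 2).1, _, htS,
        key' _ _ _ _ _ _ hw0 hw1 hw2 hsum' hpos⟩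

theorem GenPos.mono {S T : Finset Pt} (hT : GenPos T) (h : S ⊆ T) : GenPos S :=
  fun p hp q hq r hr => hT p (h hp) q (h hq) r (h hr)

/-- Moving one point of a nonconvex set in general position slightly keeps the set nonconvex. -/
theorem GenPos.eventually_not_convexPos_insert {p : Pt} {S : Finset Pt}
    (h : GenPos (insert p S)) (hS : ¬ ConvexPos (insert p S)) :
    ∀ᶠ x in 𝓝 p, ¬ ConvexPos (insert x S) := by
  obtain ⟨a, ha, b, hb, c, hc, t, ht, habct⟩ := h.exists_inside hS
  let f : Pt → Pt → Pt := fun y x => if y = p then x else y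
  have hf : ∀ y, Continuous (f y) := fun y => by
    by_cases hy : y = p
    · simp only [f, if_pos hy]; exact continuous_id
    · simp only [f, if_neg hy]; exact continuous_const
  have hfp : ∀ y, f y p = y := fun y => by simp +contextual [f, eq_comm]
  have hmem : ∀ x, ∀ y ∈ insert p S, f y x ∈ insert x S := fun x y hy => by
    by_cases hyp : y = p
    · simp [f, hyp]
    · simpa [f, hyp] using Or.inr (Finset.mem_of_mem_insert_of_ne hy hyp)
  have key : ∀ y z w, 0 < det y z w → ∀ᶠ x in 𝓝 p, 0 < det (f y x) (f z x) (f w x) :=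
    fun y z w hyzw => (continuous_det (hf y) (hf z) (hf w)).continuousAt.eventually_const_lt
      (by simpa only [hfp] using hyzw)
  filter_upwards [key _ _ _ habct.1, key _ _ _ habct.2.1, key _ _ _ habct.2.2] with x h1 h2 h3
  exact Inside.not_convexPos ⟨h1, h2, h3⟩ (hmem x a ha) (hmem x b hb) (hmem x c hc) (hmem x t ht)

/-- If the line through `p` with direction `v` crosses the segment `qr`, then no point `x` close
to `p` in direction `v` is in convex position together with `p`, `q` and `r`. -/
theorem eventually_not_convexPos_of_cross {p q r v : Pt} (hpqr : det p q r ≠ 0)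
    (hq : 0 < cross v (q - p)) (hr : cross v (r - p) < 0) :
    ∀ᶠ ε : ℝ in 𝓝[>] 0, ∀ S : Finset Pt, p ∈ S → p + ε • v ∈ S → q ∈ S → r ∈ S →
      ¬ ConvexPos S := by
  have hpos : ∀ᶠ ε : ℝ in 𝓝[>] 0, 0 < ε := self_mem_nhdsWithin
  rcases hpqr.lt_or_gt with hneg | hgt
  · have hcont : Continuous fun ε : ℝ => det r q (p + ε • v) :=
      continuous_det continuous_const continuous_const (by fun_prop)
    have hev : ∀ᶠ ε : ℝ in 𝓝[>] 0, 0 < det r q (p + ε • v) :=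
      nhdsWithin_le_nhds <| hcont.continuousAt.eventually_const_lt <| by
        beta_reduce
        rw [zero_smul, add_zero, det_rotate, det_swap_right]
        linarith
    filter_upwards [hpos, hev] with ε hε hrq S hpS hxS hqS hrS
    refine Inside.not_convexPos (a := p) (b := r) (c := q) ⟨?_, hrq, ?_⟩ hpS hrS hqS hxS
    · rw [show det p r (p + ε • v) = ε * -cross v (r - p) by simp [det, cross]; ring]
      exact mul_pos hε (neg_pos.2 hr)
    · rw [show det q p (p + ε • v) = ε * cross v (q - p) by simp [det, cross]; ring]
      exact mul_pos hε hq
  · filter_upwards [hpos] with ε hε S hpS hxS hqS hrS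
    refine Inside.not_convexPos (a := p + ε • v) (b := q) (c := r) ⟨?_, ?_, ?_⟩ hxS hqS hrS hpS
    · rw [show det (p + ε • v) q p = ε * cross v (q - p) by simp [det, cross]; ring]
      exact mul_pos hε hq
    · rwa [det_rotate]
    · rw [show det r (p + ε • v) p = ε * -cross v (r - p) by simp [det, cross]; ring]
      exact mul_pos hε (neg_pos.2 hr)

/-- Adding a point infinitesimally close to `p`, in a direction such that the line through `p`
crosses each convex quadrilateral with vertex `p`, creates no convex pentagon. -/
theorem exists_insert_of_splits {P : Finset Pt} (hgp : GenPos P)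
    (hno : ¬ ∃ S ⊆ P, S.card = 5 ∧ ConvexPos S) {p v : Pt} (hp : p ∈ P)
    (hv : v ≠ 0) (hvP : ∀ q ∈ P, q ≠ p → cross v (q - p) ≠ 0)
    (hsplit : ∀ Q ⊆ P.erase p, Q.card = 3 → ConvexPos (insert p Q) →
      ∃ q ∈ Q, ∃ r ∈ Q, 0 < cross v (q - p) ∧ cross v (r - p) < 0) :
    ∃ x, x ∉ P ∧ GenPos (insert x P) ∧
      ¬ ∃ S ⊆ insert x P, S.card = 5 ∧ ConvexPos S := by
  have hpos : ∀ᶠ ε : ℝ in 𝓝[>] 0, 0 < ε := self_mem_nhdsWithin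
  have hlim : Tendsto (fun ε : ℝ => p + ε • v) (𝓝[>] 0) (𝓝 p) := by
    have hcont : Continuous fun ε : ℝ => p + ε • v := by fun_prop
    simpa using (hcont.tendsto 0).mono_left nhdsWithin_le_nhds
  have hreplace : ∀ᶠ ε : ℝ in 𝓝[>] 0, ∀ S ∈ (P.erase p).powerset, S.card = 4 →
      ¬ ConvexPos (insert (p + ε • v) S) := by
    refine (eventually_all_finset _).2 fun S hS => ?_
    by_cases hcard : S.card = 4
    · have hpS : p ∉ S := fun h => by simpa using Finset.mem_powerset.1 hS h
      have hsub : insert p S ⊆ P := Finset.insert_subset hp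
        ((Finset.mem_powerset.1 hS).trans (Finset.erase_subset _ _))
      have hconv : ¬ ConvexPos (insert p S) := fun h =>
        hno ⟨_, hsub, by rw [Finset.card_insert_of_notMem hpS, hcard], h⟩
      filter_upwards [hlim.eventually ((hgp.mono hsub).eventually_not_convexPos_insert hconv)]
        with ε hε _ using hε
    · simp [hcard]
  have hdet : ∀ᶠ ε : ℝ in 𝓝[>] 0, ∀ q ∈ P, ∀ r ∈ P, q ≠ p → r ≠ p → q ≠ r →
      det (p + ε • v) q r ≠ 0 := by
    refine (eventually_all_finset _).2 fun q hq => (eventually_all_finset _).2 fun r hr => ?_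
    simp only [eventually_imp_distrib_left]
    intro hqp hrp hqr
    have hcont : Continuous fun x : Pt => det x q r :=
      continuous_det continuous_id continuous_const continuous_const
    exact hlim.eventually <| hcont.continuousAt.eventually_ne <|
      hgp.det_ne_zero hp hq hr hqp.symm hrp.symm hqr
  have hcross : ∀ᶠ ε : ℝ in 𝓝[>] 0, ∀ q ∈ P, ∀ r ∈ P, 0 < cross v (q - p) →
      cross v (r - p) < 0 → ∀ S : Finset Pt, p ∈ S → p + ε • v ∈ S → q ∈ S → r ∈ S →
      ¬ ConvexPos S := by
    refine (eventually_all_finset _).2 fun q hq => (eventually_all_finset _).2 fun r hr => ?_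
    rw [eventually_imp_distrib_left]
    intro hq0
    rw [eventually_imp_distrib_left]
    intro hr0
    refine eventually_not_convexPos_of_cross (hgp.det_ne_zero hp hq hr ?_ ?_ ?_) hq0 hr0
    · rintro rfl; simp [cross] at hq0
    · rintro rfl; simp [cross] at hr0
    · rintro rfl; exact hq0.not_gt hr0
  obtain ⟨ε, hε, hreplace, hdet, hcross⟩ := (hpos.and (hreplace.and (hdet.and hcross))).exists
  have hxP : p + ε • v ∉ P := by
    intro hx
    have hxp : p + ε • v ≠ p := by simp [hε.ne', hv]
    refine hvP _ hx hxp ?_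
    simp [cross]
    ring
  refine ⟨p + ε • v, hxP, hgp.insert_of_det_ne_zero ?_, ?_⟩
  · intro q hq r hr hqr
    by_cases hqp : q = p
    · subst hqp
      rw [show det (q + ε • v) q r = -(ε * cross v (r - q)) by simp [det, cross]; ring]
      exact neg_ne_zero.2 (mul_ne_zero hε.ne' (hvP r hr hqr.symm))
    by_cases hrp : r = p
    · subst hrp
      rw [show det (r + ε • v) q r = ε * cross v (q - r) by simp [det, cross]; ring]
      exact mul_ne_zero hε.ne' (hvP q hq hqr)
    exact hdet q hq r hr hqp hrp hqr
  · rintro ⟨S, hS, hcard, hconv⟩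
    have hxS : p + ε • v ∈ S := by
      by_contra hxS
      exact hno ⟨S, (Finset.subset_insert_iff_of_notMem hxS).1 hS, hcard, hconv⟩
    have hsub : S.erase (p + ε • v) ⊆ P := Finset.subset_insert_iff.1 hS
    have hcard4 : (S.erase (p + ε • v)).card = 4 := by
      rw [Finset.card_erase_of_mem hxS, hcard]
    by_cases hpS : p ∈ S.erase (p + ε • v)
    · obtain ⟨q, hq, r, hr, hq0, hr0⟩ := hsplit ((S.erase (p + ε • v)).erase p)
        (Finset.erase_subset_erase p hsub) (by rw [Finset.card_erase_of_mem hpS, hcard4])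
        (by rw [Finset.insert_erase hpS]; exact hconv.mono (Finset.erase_subset _ _))
      have hq' := Finset.mem_of_mem_erase hq
      have hr' := Finset.mem_of_mem_erase hr
      exact hcross q (hsub hq') r (hsub hr') hq0 hr0 S (Finset.mem_of_mem_erase hpS) hxS
        (Finset.mem_of_mem_erase hq') (Finset.mem_of_mem_erase hr') hconv
    · refine hreplace _ (Finset.mem_powerset.2 ?_) hcard4 (by rwa [Finset.insert_erase hxS])
      exact Finset.subset_erase.2 ⟨hsub, hpS⟩

/-- The line through `p` and `q` can be turned slightly around `p`, so that `q` gets on the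
prescribed side and the other points stay on their sides. -/
theorem GenPos.exists_turned_direction {P : Finset Pt} (h : GenPos P) {p q : Pt} (hp : p ∈ P)
    (hq : q ∈ P) (hpq : p ≠ q) {σ : ℝ} (hσ : σ ≠ 0) :
    ∃ v : Pt, 0 < cross v (q - p) * σ ∧
      ∀ r ∈ P, r ≠ p → r ≠ q → 0 < cross v (r - p) * det p q r := by
  let v : ℝ → Pt := fun δ => (q - p) + (δ * σ) • ((q - p).2, -(q - p).1)
  have hpos : ∀ᶠ δ : ℝ in 𝓝[>] 0, 0 < δ := self_mem_nhdsWithin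
  have hev : ∀ᶠ δ : ℝ in 𝓝[>] 0, ∀ r ∈ P, r ≠ p → r ≠ q →
      0 < cross (v δ) (r - p) * det p q r := by
    refine (eventually_all_finset _).2 fun r hr => ?_
    simp only [eventually_imp_distrib_left]
    intro hrp hrq
    have hcont : Continuous fun δ : ℝ => cross (v δ) (r - p) * det p q r := by
      unfold cross v; fun_prop
    refine nhdsWithin_le_nhds <| hcont.continuousAt.eventually_const_lt ?_
    have h0 : cross (v 0) (r - p) = det p q r := by
      simp only [v, zero_mul, zero_smul, add_zero, det_eq_cross]
    beta_reduce
    rw [h0]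
    exact mul_self_pos.2 (h.det_ne_zero hp hq hr hpq hrp.symm hrq.symm)
  obtain ⟨δ, hδ, hr⟩ := (hpos.and hev).exists
  refine ⟨v δ, ?_, hr⟩
  have hne : q.1 - p.1 ≠ 0 ∨ q.2 - p.2 ≠ 0 := by
    by_contra! h0
    exact hpq (Prod.ext (sub_eq_zero.1 h0.1).symm (sub_eq_zero.1 h0.2).symm)
  have hsq : 0 < (q.1 - p.1) ^ 2 + (q.2 - p.2) ^ 2 := by
    rcases hne with h0 | h0 <;> positivity
  rw [show cross (v δ) (q - p) * σ = δ * σ ^ 2 * ((q.1 - p.1) ^ 2 + (q.2 - p.2) ^ 2) by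
    simp [v, cross]; ring]
  positivity

theorem exists_equiv_fin_of_total {α : Type*} [Fintype α] (r : α → α → Prop) [IsTrans α r]
    [Std.Antisymm r] [Std.Total r] {n : ℕ} (hcard : Fintype.card α = n) :
    ∃ e : Fin n ≃ α, ∀ i j, i < j → r (e i) (e j) := by
  let order : LinearOrder α :=
    { le := r
      le_refl := fun a => (total_of r a a).elim id id
      le_trans := fun _ _ _ => trans_of r
      le_antisymm := fun _ _ => antisymm_of r
      le_total := total_of r
      toDecidableLE := Classical.decRel r }
  let e := Fintype.orderIsoFinOfCardEq α hcard
  exact ⟨e.toEquiv, fun i j hij => e.monotone hij.le⟩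

/-- A point set in general position can be labelled so that the points other than the first
are sorted by angle around the first. -/
theorem GenPos.exists_sorted_labelling {P : Finset Pt} {n : ℕ} (h : GenPos P)
    (hcard : P.card = n + 1) :
    ∃ x : Fin (n + 1) → Pt, Function.Injective x ∧ (∀ p, p ∈ P ↔ ∃ i, x i = p) ∧
      ∀ i j, 0 < i → i < j → 0 < det (x 0) (x i) (x j) := by
  have hne : P.Nonempty := Finset.card_pos.1 (by omega)
  obtain ⟨p, hp, hmin⟩ := P.exists_min_image (fun q : Pt => toLex q) hne
  have hlex : ∀ q ∈ P.erase p, 0 < q.1 - p.1 ∨ q.1 - p.1 = 0 ∧ 0 < q.2 - p.2 := by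
    intro q hq
    have hle := Prod.Lex.le_iff.1 (hmin q (Finset.mem_of_mem_erase hq))
    simp only [ofLex_toLex] at hle
    rcases hle with hlt | ⟨heq, hle⟩
    · exact Or.inl (sub_pos.2 hlt)
    · refine Or.inr ⟨sub_eq_zero.2 heq.symm, sub_pos.2 (hle.lt_of_ne fun h2 => ?_)⟩
      exact Finset.ne_of_mem_erase hq (Prod.ext heq.symm h2.symm)
  have hdet : ∀ a b : P.erase p, a ≠ b → det p a b ≠ 0 := fun a b hab =>
    h.det_ne_zero hp (Finset.mem_of_mem_erase a.2) (Finset.mem_of_mem_erase b.2)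
      (Finset.ne_of_mem_erase a.2).symm (Finset.ne_of_mem_erase b.2).symm
      (fun hab' => hab (Subtype.ext hab'))
  let r : P.erase p → P.erase p → Prop := fun a b => 0 ≤ det p a b
  have htrans : IsTrans (P.erase p) r := ⟨fun a b c hab hbc => by
    rcases eq_or_ne b c with rfl | hne
    · exact hab
    have hbc' := lt_of_le_of_ne hbc (hdet b c hne).symm
    have ha := hlex a a.2
    have hb := hlex b b.2
    have hc := hlex c c.2
    simp only [r, det] at hab hbc' ⊢
    generalize (a : Pt).1 - p.1 = a1 at *
    generalize (a : Pt).2 - p.2 = a2 at *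
    generalize (b : Pt).1 - p.1 = b1 at *
    generalize (b : Pt).2 - p.2 = b2 at *
    generalize (c : Pt).1 - p.1 = c1 at *
    generalize (c : Pt).2 - p.2 = c2 at *
    have hc1 : 0 ≤ c1 := by rcases hc with hc | hc <;> linarith
    have ha1 : 0 ≤ a1 := by rcases ha with ha | ha <;> linarith
    rcases hb with hb | ⟨rfl, hb⟩
    · have : 0 ≤ b1 * (a1 * c2 - a2 * c1) := by
        nlinarith [mul_nonneg ha1 hbc'.le, mul_nonneg hc1 hab]
      exact nonneg_of_mul_nonneg_right this hb
    · nlinarith⟩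
  have hantisymm : Std.Antisymm r := ⟨fun a b hab hba => by
    by_contra hne
    refine hdet a b hne (le_antisymm ?_ hab)
    simp only [r, det_swap_right p (a : Pt)] at hba
    linarith⟩
  have htotal : Std.Total r := ⟨fun a b => by
    simp only [r, det_swap_right p (a : Pt) b, neg_nonneg]
    exact le_total 0 _⟩
  have hcard' : Fintype.card (P.erase p) = n := by
    rw [Fintype.card_coe, Finset.card_erase_of_mem hp, hcard, Nat.add_sub_cancel]
  obtain ⟨e, he⟩ := exists_equiv_fin_of_total r hcard'
  refine ⟨Fin.cons p fun i => (e i : Pt), ?_, ?_, ?_⟩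
  · rw [Fin.cons_injective_iff]
    refine ⟨?_, Subtype.val_injective.comp e.injective⟩
    rintro ⟨i, hi⟩
    exact Finset.ne_of_mem_erase (e i).2 hi
  · intro q
    rw [Fin.exists_fin_succ]
    simp only [Fin.cons_zero, Fin.cons_succ]
    constructor
    · intro hq
      rcases eq_or_ne q p with rfl | hqp
      · exact Or.inl rfl
      · exact Or.inr ⟨e.symm ⟨q, Finset.mem_erase.2 ⟨hqp, hq⟩⟩, by simp⟩
    · rintro (rfl | ⟨i, rfl⟩)
      · exact hp
      · exact Finset.mem_of_mem_erase (e i).2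
  · intro i j hi hij
    obtain ⟨i, rfl⟩ := Fin.exists_succ_eq.2 hi.ne'
    obtain ⟨j, rfl⟩ := Fin.exists_succ_eq.2 (hi.trans hij).ne'
    have hlt : i < j := Fin.succ_lt_succ_iff.1 hij
    simp only [Fin.cons_zero, Fin.cons_succ]
    exact lt_of_le_of_ne (he i j hlt) (hdet _ _ (e.injective.ne hlt.ne)).symm

/-- The extension to all triples of the orientation `g` of increasing triples. -/
def alternate (g : Fin 6 → Fin 6 → Fin 6 → Bool) (i j k : Fin 6) : Bool :=
  if i < j then
    if j < k then g i j k
    else if i < k then (if k < j then !g i k j else false)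
    else if k < i then g k i j else false
  else if j < i then
    if i < k then !g j i k
    else if j < k then (if k < i then g j k i else false)
    else if k < j then !g k j i else false
  else false

/-- The orientation of increasing triples when the points `1, …, 5` are sorted by angle
around the point `0`; the arguments are the orientations of the triples avoiding `0`. -/
def sortedOrient (b123 b124 b134 b234 b125 b135 b145 b235 b245 b345 : Bool)
    (i j k : Fin 6) : Bool :=
  if i = 0 then true
  else if i = 1 then
    if j = 2 then (if k = 3 then b123 else if k = 4 then b124 else b125)
    else if j = 3 then (if k = 4 then b134 else b135)
    else b145
  else if i = 2 then
    if j = 3 then (if k = 4 then b234 else b235) else b245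
  else b345

/-- The point `t` is inside the counterclockwise triangle `abc`, for the orientation `s`. -/
def InsideOrient (s : Fin 6 → Fin 6 → Fin 6 → Bool) (a b c t : Fin 6) : Prop :=
  s a b t = true ∧ s b c t = true ∧ s c a t = true

instance (s : Fin 6 → Fin 6 → Fin 6 → Bool) (a b c t : Fin 6) :
    Decidable (InsideOrient s a b c t) :=
  inferInstanceAs (Decidable (_ ∧ _ ∧ _))

/-- A sequence of four signs changes at most once. -/
def AtMostOneChange (a b c d : Bool) : Prop :=
  (a = c → b = a) ∧ (a = d → b = a) ∧ (a = d → c = a) ∧ (b = d → c = b)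

instance (a b c d : Bool) : Decidable (AtMostOneChange a b c d) :=
  inferInstanceAs (Decidable (_ ∧ _ ∧ _ ∧ _))

/-- The side on which the point `k` lies of a line through the point `p` obtained by slightly
turning the line `pq`, so that `q` lies on the side `σ`. -/
def turnedSide (s : Fin 6 → Fin 6 → Fin 6 → Bool) (p q : Fin 6) (σ : Bool) (k : Fin 6) : Bool :=
  if k = q then σ else s p q k

/-- The line through `p` described by `turnedSide` splits each triple of other points that is
in convex position together with `p`. -/
def Stabs (s : Fin 6 → Fin 6 → Fin 6 → Bool) (p q : Fin 6) (σ : Bool) : Prop :=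
  ∀ i, i ≠ p → ∀ j, j ≠ p → j ≠ i → ∀ k, k ≠ p → k ≠ i → k ≠ j →
    turnedSide s p q σ i ≠ turnedSide s p q σ j ∨ turnedSide s p q σ i ≠ turnedSide s p q σ k ∨
    ∃ a ∈ [p, i, j, k], ∃ b ∈ [p, i, j, k], ∃ t ∈ [p, i, j, k], s a b t = true ∧
      ∃ c ∈ [p, i, j, k], InsideOrient s a b c t

instance (s : Fin 6 → Fin 6 → Fin 6 → Bool) (p q : Fin 6) (σ : Bool) :
    Decidable (Stabs s p q σ) := by
  unfold Stabs; infer_instance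

theorem exists_stabs_sortedOrient :
    ∀ b123 b124 b134 b234 : Bool, AtMostOneChange b123 b124 b134 b234 →
    ∀ b125 b135 b235 : Bool, AtMostOneChange b123 b125 b135 b235 →
    ∀ b145 b245 : Bool, AtMostOneChange b124 b125 b145 b245 →
    ∀ b345 : Bool, AtMostOneChange b134 b135 b145 b345 → AtMostOneChange b234 b235 b245 b345 →
    (∀ o : Fin 6, ∃ a, a ≠ o ∧ ∃ b, b ≠ o ∧ ∃ t, t ≠ o ∧
      alternate (sortedOrient b123 b124 b134 b234 b125 b135 b145 b235 b245 b345) a b t = true ∧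
      ∃ c, c ≠ o ∧
      InsideOrient
        (alternate (sortedOrient b123 b124 b134 b234 b125 b135 b145 b235 b245 b345)) a b c t) →
    Stabs (alternate (sortedOrient b123 b124 b134 b234 b125 b135 b145 b235 b245 b345)) 0 3 true ∨
    Stabs (alternate (sortedOrient b123 b124 b134 b234 b125 b135 b145 b235 b245 b345)) 2 0 true ∨
    Stabs (alternate (sortedOrient b123 b124 b134 b234 b125 b135 b145 b235 b245 b345)) 4 5 false := by
  decide +kernel

/-- The orientation of triples of labelled points. -/
def pointOrient (x : Fin 6 → Pt) (i j k : Fin 6) : Bool :=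
  decide (0 < det (x i) (x j) (x k))

theorem insideOrient_pointOrient_iff (x : Fin 6 → Pt) (a b c t : Fin 6) :
    InsideOrient (pointOrient x) a b c t ↔ Inside (x a) (x b) (x c) (x t) := by
  simp [InsideOrient, Inside, pointOrient]

/-- If `i`, `j`, `k`, `l` are sorted by angle around `o`, then the orientations of the triples
formed by them change sign at most once. -/
theorem atMostOneChange_of_sorted {o i j k l : Pt} (hij : 0 < det o i j) (hik : 0 < det o i k)
    (hil : 0 < det o i l) (hjk : 0 < det o j k) (hjl : 0 < det o j l) (hkl : 0 < det o k l)
    (h1 : det i j k ≠ 0) (h2 : det i j l ≠ 0) (h3 : det i k l ≠ 0) (h4 : det j k l ≠ 0) :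
    AtMostOneChange (decide (0 < det i j k)) (decide (0 < det i j l)) (decide (0 < det i k l))
      (decide (0 < det j k l)) := by
  have e1 : det o i j * det i k l + det o i l * det i j k = det o i k * det i j l := by
    unfold det; ring
  have e2 : det o i j * det j k l + det o j l * det i j k = det o j k * det i j l := by
    unfold det; ring
  have e3 : det o i k * det j k l + det o k l * det i j k = det o j k * det i k l := by
    unfold det; ring
  have e4 : det o i l * det j k l + det o k l * det i j l = det o j l * det i k l := by
    unfold det; ring
  have between : ∀ a b c u v w : ℝ, 0 < a → 0 < b → 0 < c → v ≠ 0 → a * u + b * w = c * v →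
      u ≠ 0 → w ≠ 0 → (decide (0 < w) = decide (0 < u) → decide (0 < v) = decide (0 < w)) := by
    intro a b c u v w ha hb hc hv h hu hw huw
    rw [decide_eq_decide] at huw ⊢
    rcases hw.lt_or_gt with hw | hw
    · have hu' : u < 0 := hu.lt_of_le (not_lt.1 fun h0 => hw.not_gt (huw.2 h0))
      refine iff_of_false (fun h0 => ?_) hw.not_gt
      linarith [mul_neg_of_pos_of_neg ha hu', mul_neg_of_pos_of_neg hb hw, mul_pos hc h0]
    · refine iff_of_true (pos_of_mul_pos_right ?_ hc.le) hw
      rw [← h]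
      linarith [mul_pos ha (huw.1 hw), mul_pos hb hw]
  exact ⟨between _ _ _ _ _ _ hij hil hik h2 e1 h3 h1, between _ _ _ _ _ _ hij hjl hjk h2 e2 h4 h1,
    between _ _ _ _ _ _ hik hkl hjk h3 e3 h4 h1, between _ _ _ _ _ _ hil hkl hjl h3 e4 h4 h2⟩

theorem alternate_pointOrient {x : Fin 6 → Pt}
    (hx : ∀ i j k, i ≠ j → i ≠ k → j ≠ k → det (x i) (x j) (x k) ≠ 0)
    {g : Fin 6 → Fin 6 → Fin 6 → Bool}
    (hg : ∀ i j k, i < j → j < k → g i j k = pointOrient x i j k) :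
    alternate g = pointOrient x := by
  have hright : ∀ i j k, i ≠ j → i ≠ k → j ≠ k →
      (!pointOrient x i k j) = pointOrient x i j k := by
    intro i j k hij hik hjk
    have h0 := hx i j k hij hik hjk
    unfold pointOrient
    rw [det_swap_right, ← decide_not, decide_eq_decide, not_lt]
    constructor
    · intro h; exact lt_of_le_of_ne (by linarith) h0.symm
    · intro h; linarith
  have hrot : ∀ i j k, pointOrient x j k i = pointOrient x i j k := fun i j k => by
    unfold pointOrient; rw [det_rotate]
  have heq : ∀ i j k, i = j ∨ i = k ∨ j = k → pointOrient x i j k = false := by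
    rintro i j k (rfl | rfl | rfl) <;> simp [pointOrient]
  funext i j k
  unfold alternate
  split_ifs with h1 h2 h3 h4 h5 h6 h7 h8 h9 h10
  · exact hg _ _ _ h1 h2
  · rw [hg _ _ _ h3 h4]; exact hright _ _ _ h1.ne h3.ne h4.ne'
  · exact (heq _ _ _ (by omega)).symm
  · rw [hg _ _ _ h5 h1]; exact hrot _ _ _ |>.symm
  · exact (heq _ _ _ (by omega)).symm
  · rw [hg _ _ _ h6 h7, ← hrot j i k]; exact hright _ _ _ h6.ne' h7.ne (h6.trans h7).ne
  · rw [hg _ _ _ h8 h9]; exact hrot _ _ _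
  · exact (heq _ _ _ (by omega)).symm
  · rw [hg _ _ _ h10 h6, hrot i k j]; exact hright _ _ _ h6.ne' (h10.trans h6).ne' h10.ne'
  · exact (heq _ _ _ (by omega)).symm
  · exact (heq _ _ _ (by omega)).symm

/-- No 6-point set is a bad configuration for the convex 5-gon game. -/
theorem stmt10 (P : Finset Pt) (hcard : P.card = 6) (hgp : GenPos P)
    (hno : ¬ ∃ S ⊆ P, S.card = 5 ∧ ConvexPos S) :
    ∃ x, x ∉ P ∧ GenPos (insert x P) ∧
      ¬ ∃ S ⊆ insert x P, S.card = 5 ∧ ConvexPos S := by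
  obtain ⟨x, hinj, hP, hsort⟩ := hgp.exists_sorted_labelling (n := 5) hcard
  have hmem : ∀ i, x i ∈ P := fun i => (hP _).2 ⟨i, rfl⟩
  have hdet : ∀ i j k, i ≠ j → i ≠ k → j ≠ k → det (x i) (x j) (x k) ≠ 0 :=
    fun i j k hij hik hjk => hgp.det_ne_zero (hmem i) (hmem j) (hmem k) (hinj.ne hij)
      (hinj.ne hik) (hinj.ne hjk)
  have hside : ∀ i j k, i ≠ j → i ≠ k → j ≠ k →
      (pointOrient x i j k = false ↔ det (x i) (x j) (x k) < 0) := fun i j k hij hik hjk => by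
    simp [pointOrient, le_iff_lt_or_eq, hdet i j k hij hik hjk]
  have hnonconvex : ∀ o : Fin 6, ∃ a, a ≠ o ∧ ∃ b, b ≠ o ∧ ∃ t, t ≠ o ∧
      pointOrient x a b t = true ∧ ∃ c, c ≠ o ∧ InsideOrient (pointOrient x) a b c t := by
    intro o
    have hsub : P.erase (x o) ⊆ P := Finset.erase_subset _ _
    obtain ⟨a, ha, b, hb, c, hc, t, ht, h⟩ := (hgp.mono hsub).exists_inside fun hconv =>
      hno ⟨_, hsub, by rw [Finset.card_erase_of_mem (hmem o), hcard], hconv⟩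
    have hlabel : ∀ y ∈ P.erase (x o), ∃ i, i ≠ o ∧ x i = y := fun y hy => by
      obtain ⟨i, rfl⟩ := (hP y).1 (Finset.mem_of_mem_erase hy)
      exact ⟨i, fun hio => Finset.ne_of_mem_erase hy (congrArg x hio), rfl⟩
    obtain ⟨a, ha', rfl⟩ := hlabel a ha
    obtain ⟨b, hb', rfl⟩ := hlabel b hb
    obtain ⟨c, hc', rfl⟩ := hlabel c hc
    obtain ⟨t, ht', rfl⟩ := hlabel t ht
    have h' := (insideOrient_pointOrient_iff x a b c t).2 h
    exact ⟨a, ha', b, hb', t, ht', h'.1, c, hc', h'⟩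
  have hchange : ∀ i j k l, 0 < i → i < j → j < k → k < l →
      AtMostOneChange (pointOrient x i j k) (pointOrient x i j l) (pointOrient x i k l)
        (pointOrient x j k l) := fun i j k l hi hij hjk hkl =>
    have hj := hi.trans hij
    have hik := hij.trans hjk
    have hjl := hjk.trans hkl
    have hil := hij.trans hjl
    atMostOneChange_of_sorted (hsort i j hi hij) (hsort i k hi hik) (hsort i l hi hil)
      (hsort j k hj hjk) (hsort j l hj hjl) (hsort k l (hj.trans hjk) hkl)
      (hdet _ _ _ hij.ne hik.ne hjk.ne) (hdet _ _ _ hij.ne hil.ne hjl.ne)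
      (hdet _ _ _ hik.ne hil.ne hkl.ne) (hdet _ _ _ hjk.ne hjl.ne hkl.ne)
  have hstabs : ∃ p q σ, p ≠ q ∧ Stabs (pointOrient x) p q σ := by
    have halt := alternate_pointOrient hdet (g := sortedOrient (pointOrient x 1 2 3)
      (pointOrient x 1 2 4) (pointOrient x 1 3 4) (pointOrient x 2 3 4) (pointOrient x 1 2 5)
      (pointOrient x 1 3 5) (pointOrient x 1 4 5) (pointOrient x 2 3 5) (pointOrient x 2 4 5)
      (pointOrient x 3 4 5)) <| by
        intro i j k hij hjk
        by_cases hi : i = 0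
        · subst hi
          simpa [sortedOrient, pointOrient] using hsort j k hij hjk
        · fin_cases i <;> fin_cases j <;> fin_cases k <;> first | rfl | simp at hi hij hjk
    have key := exists_stabs_sortedOrient _ _ _ _ (hchange 1 2 3 4 (by decide) (by decide)
      (by decide) (by decide)) _ _ _ (hchange 1 2 3 5 (by decide) (by decide) (by decide)
      (by decide)) _ _ (hchange 1 2 4 5 (by decide) (by decide) (by decide) (by decide)) _
      (hchange 1 3 4 5 (by decide) (by decide) (by decide) (by decide))
      (hchange 2 3 4 5 (by decide) (by decide) (by decide) (by decide))
    rw [halt] at key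
    rcases key hnonconvex with h | h | h
    · exact ⟨_, _, _, by decide, h⟩
    · exact ⟨_, _, _, by decide, h⟩
    · exact ⟨_, _, _, by decide, h⟩
  obtain ⟨p, q, σ, hpq, hstabs⟩ := hstabs
  obtain ⟨v, hvq, hv⟩ := hgp.exists_turned_direction (hmem p) (hmem q) (hinj.ne hpq)
    (σ := if σ then 1 else -1) (by split_ifs <;> norm_num)
  have hturned : ∀ k, k ≠ p → (turnedSide (pointOrient x) p q σ k = true ∧
      0 < cross v (x k - x p) ∨ turnedSide (pointOrient x) p q σ k = false ∧
      cross v (x k - x p) < 0) := by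
    intro k hkp
    by_cases hkq : k = q
    · subst hkq
      cases σ <;> simpa [turnedSide] using hvq
    · have h := hv (x k) (hmem k) (hinj.ne hkp) (hinj.ne hkq)
      simp only [turnedSide, if_neg hkq]
      rcases pos_and_pos_or_neg_and_neg_of_mul_pos h with h | h
      · exact Or.inl ⟨by simpa [pointOrient] using h.2, h.1⟩
      · exact Or.inr ⟨(hside p q k hpq hkp.symm (Ne.symm hkq)).2 h.2, h.1⟩
  refine exists_insert_of_splits hgp hno (hmem p) (v := v) ?_ ?_ ?_
  · rintro rfl
    simp [cross] at hvq
  · intro y hy hyp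
    obtain ⟨k, rfl⟩ := (hP y).1 hy
    rcases hturned k (fun h => hyp (congrArg x h)) with h | h
    · exact h.2.ne'
    · exact h.2.ne
  · intro Q hQ hQcard hconv
    obtain ⟨a, b, c, hab, hac, hbc, rfl⟩ := Finset.card_eq_three.1 hQcard
    have hlabel : ∀ y ∈ ({a, b, c} : Finset Pt), ∃ i, i ≠ p ∧ x i = y := fun y hy => by
      obtain ⟨i, rfl⟩ := (hP y).1 (Finset.mem_of_mem_erase (hQ hy))
      exact ⟨i, fun hio => Finset.ne_of_mem_erase (hQ hy) (congrArg x hio), rfl⟩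
    obtain ⟨i, hi, rfl⟩ := hlabel a (by simp)
    obtain ⟨j, hj, rfl⟩ := hlabel b (by simp)
    obtain ⟨k, hk, rfl⟩ := hlabel c (by simp)
    have hsplit : ∀ i j, i ≠ p → j ≠ p → turnedSide (pointOrient x) p q σ i ≠
        turnedSide (pointOrient x) p q σ j → ∀ Q : Finset Pt, x i ∈ Q → x j ∈ Q →
        ∃ y ∈ Q, ∃ z ∈ Q, 0 < cross v (y - x p) ∧ cross v (z - x p) < 0 := by
      intro i j hi hj hij Q hiQ hjQ
      rcases hturned i hi with h1 | h1 <;> rcases hturned j hj with h2 | h2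
      · exact absurd (h1.1.trans h2.1.symm) hij
      · exact ⟨_, hiQ, _, hjQ, h1.2, h2.2⟩
      · exact ⟨_, hjQ, _, hiQ, h2.2, h1.2⟩
      · exact absurd (h1.1.trans h2.1.symm) hij
    rcases hstabs i hi j hj (fun h => hab (congrArg x h.symm)) k hk
      (fun h => hac (congrArg x h.symm)) (fun h => hbc (congrArg x h.symm)) with h | h | h
    · exact hsplit i j hi hj h _ (by simp) (by simp)
    · exact hsplit i k hi hk h _ (by simp) (by simp)
    · obtain ⟨a, ha, b, hb, t, ht, -, c, hc, h⟩ := h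
      have hmem' : ∀ m ∈ [p, i, j, k], x m ∈ insert (x p) ({x i, x j, x k} : Finset Pt) := by
        simp +contextual [or_imp]
      exact absurd hconv (((insideOrient_pointOrient_iff x a b c t).1 h).not_convexPos
        (hmem' a ha) (hmem' b hb) (hmem' c hc) (hmem' t ht))
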